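/- Suppose Q^{(a)}_j (1 ≤ a ≤ n, j ≥ 0) are invertible elements of a commutative ℚ-algebra satisfying the Q-system of type X_n with Q^{(a)}_0 = 1. For 0 ≤ i ≤ tl−1 and (a,j) ∈ H_l[i+1] define z^{(a)}_{j,i} = ∏_{b=1}^n (Q^{(b)}_{i_b})^{C_{ba}j − C_{ab}(i_b+1)} (Q^{(b)}_{i_b+1})^{−C_{ba}j + C_{ab}i_b}, where i_b = ⌊t_b i / t⌋ (all exponents are integers since C_{ba}t_a = C_{ab}t_b). Then: (i) these elements satisfy the recursion z^{(a)}_{j,i} = z^{(a)}_{j,i−1} ∏_{b=1}^n (1 − z^{(b)}_{(t_b/t)i,i−1})^{−C_{ba}(j−(t_a/t)i)} for (a,j) ∈ H_l[i+1], 1 ≤ i ≤ tl−1, with z^{(b)}_{(t_b/t)i,i−1} := 0 whenever (t_b/t)i ∉ ℤ; and (ii) whenever (t_a/t)i ∈ ℤ, 1 − z^{(a)}_{(t_a/t)i,i−1} = Q^{(a)}_{(t_a/t)i−1} Q^{(a)}_{(t_a/t)i+1} / (Q^{(a)}_{(t_a/t)i})². -/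

import Mathlib

open scoped BigOperators

namespace FermionicPaper

/-- The combinatorial data of a finite-dimensional simple Lie algebra `X_n` of type
`A_n, B_n, C_n, D_n, E_{6,7,8}, F_4, G_2`: the rank `n`, the numbers
`t_a = 2/(α_a|α_a) ∈ {1,2,3}` and the Cartan matrix `C_{ab} = t_a (α_a|α_b)`,
where `(·|·)` is the invariant bilinear form normalized by `(α|α) = 2` for long roots.
The axioms characterize exactly the Cartan data of the finite-dimensional simple Lie
algebras (symmetrizability, positive definiteness, connectedness, normalization). -/
structure CartanDatum (n : ℕ) : Type where
  t : Fin n → ℕ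
  C : Fin n → Fin n → ℤ
  t_pos : ∀ a, 0 < t a
  diag : ∀ a, C a a = 2
  offdiag_nonpos : ∀ a b, a ≠ b → C a b ≤ 0
  symm : ∀ a b, (t b : ℤ) * C a b = (t a : ℤ) * C b a
  posdef : ∀ v : Fin n → ℚ, v ≠ 0 → 0 < ∑ a, ∑ b, v a * ((C a b : ℚ) / (t a : ℚ)) * v b
  connected : ∀ S : Set (Fin n), S.Nonempty → (∀ a ∈ S, ∀ b, b ∉ S → C a b = 0) → ∀ a, a ∈ S
  normalized : ∃ a, t a = 1

variable {n : ℕ}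

/-- The invariant form `(α_a | α_b)`. -/
def CartanDatum.form (D : CartanDatum n) (a b : Fin n) : ℚ := (D.C a b : ℚ) / (D.t a : ℚ)

/-- `t = max_a t_a`. -/
def CartanDatum.tmax (D : CartanDatum n) : ℕ := Finset.univ.sup D.t

/-- The Cartan matrix as a rational matrix. -/
def CartanDatum.Cmat (D : CartanDatum n) : Matrix (Fin n) (Fin n) ℚ :=
  Matrix.of fun a b => (D.C a b : ℚ)

/-- The inverse Cartan matrix `C^{-1}`. -/
noncomputable def CartanDatum.Cinv (D : CartanDatum n) : Matrix (Fin n) (Fin n) ℚ := (D.Cmat)⁻¹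

/-- The invariant form on the weight space `P̄ ⊗ ℚ`, in the basis of fundamental weights;
`(Λ̄_a | Λ̄_b) = C^{-1}_{ab} / t_a`. -/
noncomputable def CartanDatum.wform (D : CartanDatum n) (μ ν : Fin n → ℚ) : ℚ :=
  ∑ a, ∑ b, μ a * (D.Cinv a b / (D.t a : ℚ)) * ν b

/-- The field `K = ℚ((q^{ℚ}))` of Hahn series in which all the `q`-series identities are stated. -/
abbrev K : Type := HahnSeries ℚ ℚ

/-- The monomial `q^c` for a rational exponent `c`. -/
noncomputable def hq (c : ℚ) : K := HahnSeries.single c 1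

/-- The extended `q`-binomial coefficient `{p+m choose m}` evaluated at `q^ε`
(`ε = 1` gives `q`, `ε = -1` gives `q^{-1}`); for `m ∈ ℤ_{≥0}` and integral `p` it equals
`(q^{p+1})_∞ (q^{m+1})_∞ / ((q)_∞ (q^{p+m+1})_∞) = ∏_{i=1}^m (1-q^{p+i})/(1-q^i)`. -/
noncomputable def qbinE (ε p : ℚ) (m : ℕ) : K :=
  ∏ i ∈ Finset.range m, (1 - hq (ε * (p + i + 1))) / (1 - hq (ε * (i + 1)))

/-- The truncated `q`-binomial coefficient `[p+m choose m]` at `q^ε`: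
it equals `{p+m choose m}` for `p ≥ 0` and `0` for `p < 0`. -/
noncomputable def qbinT (ε p : ℚ) (m : ℕ) : K := if 0 ≤ p then qbinE ε p m else 0

/-- `(q)_k = ∏_{j=1}^k (1 - q^j)`, at `q^ε`. -/
noncomputable def qpoch (ε : ℚ) (k : ℕ) : K := ∏ i ∈ Finset.range k, (1 - hq (ε * (i + 1)))

/-- `{p+m choose m}_1 = Γ(p+m+1)/(Γ(p+1)Γ(m+1)) = ∏_{i=1}^m (p+i)/i`, the `q = 1` value. -/
def bin1 (p : ℚ) (m : ℕ) : ℚ := ∏ i ∈ Finset.range m, (p + i + 1) / (i + 1)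

/-- A family `m^{(a)}_i` (or `ν^{(a)}_i`) has finitely many nonzero members. -/
def FinSupp (m : Fin n → ℕ → ℕ) : Prop :=
  (Function.support fun x : Fin n × ℕ => m x.1 x.2).Finite

variable (D : CartanDatum n)

/-- The vacancy numbers
`p^{(a)}_i = Σ_j ν^{(a)}_j min(i,j) − Σ_b (α_a|α_b) Σ_k min(t_b i, t_a k) m^{(b)}_k`. -/
noncomputable def pinf (ν m : Fin n → ℕ → ℕ) (a : Fin n) (i : ℕ) : ℚ :=
  (∑ᶠ j : ℕ, (ν a j : ℚ) * (min i j : ℕ))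
    - ∑ b, ∑ᶠ k : ℕ, D.form a b * (min (D.t b * i) (D.t a * k) : ℕ) * (m b k)

/-- The quadratic form
`c({m}) = ½ Σ_{a,b} (α_a|α_b) Σ_{j,k} min(t_b j, t_a k) m^{(a)}_j m^{(b)}_k
  − Σ_a Σ_{j,k} ν^{(a)}_j min(j,k) m^{(a)}_k` (allowing rational arguments `m`). -/
noncomputable def cinf (ν : Fin n → ℕ → ℕ) (m : Fin n → ℕ → ℚ) : ℚ :=
  (1/2) * (∑ a, ∑ b, ∑ᶠ j : ℕ, ∑ᶠ k : ℕ,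
      D.form a b * (min (D.t b * j) (D.t a * k) : ℕ) * m a j * m b k)
    - ∑ a, ∑ᶠ j : ℕ, ∑ᶠ k : ℕ, (ν a j : ℚ) * (min j k : ℕ) * m a k

/-- `c({m})` for integral `m`. -/
noncomputable def cinfN (ν m : Fin n → ℕ → ℕ) : ℚ := cinf D ν (fun a j => (m a j : ℚ))

/-- The constraint `Σ_{a,i} i m^{(a)}_i α_a = Σ_{a,i} i ν^{(a)}_i Λ̄_a − λ`, written in
the coordinates of the fundamental weight basis (`α_a = Σ_b C_{ba} Λ̄_b`). -/
def Constr (ν m : Fin n → ℕ → ℕ) (lam : Fin n → ℚ) : Prop :=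
  ∀ b, (∑ a, ∑ᶠ i : ℕ, (i : ℚ) * m a i * D.C b a) = (∑ᶠ i : ℕ, (i : ℚ) * ν b i) - lam b

/-- The admissible configurations for the fermionic form `M(W,λ,q)`. -/
def admM (ν : Fin n → ℕ → ℕ) (lam : Fin n → ℚ) : Set (Fin n → ℕ → ℕ) :=
  {m | FinSupp m ∧ Constr D ν m lam ∧ ∀ a, ∀ i : ℕ, 1 ≤ i → 0 ≤ pinf D ν m a i}

/-- The fermionic form `M(W,λ,q^ε)` for `W = ⊗_{a,j} (W^{(a)}_j)^{⊗ ν^{(a)}_j}` and `λ ∈ P̄`. -/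
noncomputable def M (ε : ℚ) (ν : Fin n → ℕ → ℕ) (lam : Fin n → ℚ) : K :=
  ∑ᶠ m ∈ admM D ν lam,
    hq (ε * cinfN D ν m) *
      ∏ᶠ a : Fin n, ∏ᶠ i ∈ {i : ℕ | 1 ≤ i}, qbinT ε (pinf D ν m a i) (m a i)

/-- Level-`l` restricted vacancy numbers (all indices restricted to `H_l`). -/
noncomputable def pl (l : ℕ) (ν m : Fin n → ℕ → ℕ) (a : Fin n) (i : ℕ) : ℚ :=
  (∑ j ∈ Finset.Icc 1 (D.t a * l), (ν a j : ℚ) * (min j i : ℕ))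
    - ∑ b, ∑ k ∈ Finset.Icc 1 (D.t b * l),
        D.form a b * (min (D.t b * i) (D.t a * k) : ℕ) * (m b k)

/-- Level-`l` restricted quadratic form `c_l({m})`. -/
noncomputable def cl (l : ℕ) (ν m : Fin n → ℕ → ℕ) : ℚ :=
  (1/2) * (∑ a, ∑ b, ∑ j ∈ Finset.Icc 1 (D.t a * l), ∑ k ∈ Finset.Icc 1 (D.t b * l),
      D.form a b * (min (D.t b * j) (D.t a * k) : ℕ) * (m a j) * (m b k))
    - ∑ a, ∑ j ∈ Finset.Icc 1 (D.t a * l), ∑ k ∈ Finset.Icc 1 (D.t a * l),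
        (ν a j : ℚ) * (min j k : ℕ) * (m a k)

/-- A family is supported in `H_l = {(a,j) | 1 ≤ j ≤ t_a l}`. -/
def SuppIn (l : ℕ) (m : Fin n → ℕ → ℕ) : Prop :=
  ∀ a j, m a j ≠ 0 → 1 ≤ j ∧ j ≤ D.t a * l

/-- Level-`l` constraint `Σ_{(a,i)∈H_l} i m^{(a)}_i α_a = Σ_{(a,i)∈H_l} i ν^{(a)}_i Λ̄_a − λ`. -/
def ConstrL (l : ℕ) (ν m : Fin n → ℕ → ℕ) (lam : Fin n → ℚ) : Prop :=
  ∀ b, (∑ a, ∑ i ∈ Finset.Icc 1 (D.t a * l), (i : ℚ) * m a i * D.C b a)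
      = (∑ i ∈ Finset.Icc 1 (D.t b * l), (i : ℚ) * ν b i) - lam b

/-- The level-`l` restricted fermionic form `M_l(W,q^ε)`. -/
noncomputable def Ml (ε : ℚ) (l : ℕ) (ν : Fin n → ℕ → ℕ) : K :=
  ∑ᶠ m ∈ {m | SuppIn D l m ∧ ConstrL D l ν m 0 ∧
      ∀ a, ∀ i ∈ Finset.Icc 1 (D.t a * l), 0 ≤ pl D l ν m a i},
    hq (ε * cl D l ν m) *
      ∏ a, ∏ i ∈ Finset.Icc 1 (D.t a * l), qbinT ε (pl D l ν m a i) (m a i)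

/-- The fermionic form `N_l(W,λ,q^ε)`: no positivity imposed on the vacancy numbers, and
extended `q`-binomial coefficients are used. -/
noncomputable def Nl (ε : ℚ) (l : ℕ) (ν : Fin n → ℕ → ℕ) (lam : Fin n → ℚ) : K :=
  ∑ᶠ m ∈ {m | SuppIn D l m ∧ ConstrL D l ν m lam},
    hq (ε * cl D l ν m) *
      ∏ a, ∏ i ∈ Finset.Icc 1 (D.t a * l), qbinE ε (pl D l ν m a i) (m a i)

/-- `N_∞(W,λ,q)` at `q = 1`. -/
noncomputable def Ninf1 (ν : Fin n → ℕ → ℕ) (lam : Fin n → ℚ) : ℚ :=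
  ∑ᶠ m ∈ {m | FinSupp m ∧ Constr D ν m lam},
    ∏ᶠ a : Fin n, ∏ᶠ i ∈ {i : ℕ | 1 ≤ i}, bin1 (pinf D ν m a i) (m a i)

/-- `N_l(W,λ,q)` at `q = 1`. -/
noncomputable def Nl1 (l : ℕ) (ν : Fin n → ℕ → ℕ) (lam : Fin n → ℚ) : ℚ :=
  ∑ᶠ m ∈ {m | SuppIn D l m ∧ ConstrL D l ν m lam},
    ∏ a, ∏ i ∈ Finset.Icc 1 (D.t a * l), bin1 (pl D l ν m a i) (m a i)

/-- The data of `W₁ = W^{(a₀)}_{j₀} ⊗ W^{(a₀)}_{j₀} ⊗ W`. -/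
def nu1 (ν : Fin n → ℕ → ℕ) (a₀ : Fin n) (j₀ : ℕ) : Fin n → ℕ → ℕ :=
  fun a j => ν a j + if a = a₀ ∧ j = j₀ then 2 else 0

/-- The data of `W₂ = W^{(a₀)}_{j₀+1} ⊗ W^{(a₀)}_{j₀−1} ⊗ W` (a factor with index `0`
being inert/omitted). -/
def nu2 (ν : Fin n → ℕ → ℕ) (a₀ : Fin n) (j₀ : ℕ) : Fin n → ℕ → ℕ :=
  fun a j => ν a j + (if a = a₀ ∧ j = j₀ + 1 then 1 else 0)
    + (if a = a₀ ∧ j = j₀ - 1 then 1 else 0)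

/-- The data of `W₃ = ⊗_{b ∼ a₀} ⊗_{k=0}^{-C_{a₀b}-1} W^{(b)}_{⌊(C_{b a₀} j₀ − k)/C_{a₀ b}⌋} ⊗ W`
(a factor with index `0` being inert/omitted); repeated indices are counted with
multiplicity. -/
def nu3 (ν : Fin n → ℕ → ℕ) (a₀ : Fin n) (j₀ : ℕ) : Fin n → ℕ → ℕ :=
  fun b j => ν b j +
    if D.C a₀ b < 0 then
      ((Finset.range (-(D.C a₀ b)).toNat).filter
        (fun k : ℕ => (((D.C b a₀) * (j₀ : ℤ) - (k : ℤ)).fdiv (D.C a₀ b)).toNat = j)).card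
    else 0


/-- The elements `z^{(a)}_{j,i} = ∏_b (Q^{(b)}_{i_b})^{C_{ba}j − C_{ab}(i_b+1)}
(Q^{(b)}_{i_b+1})^{−C_{ba}j + C_{ab}i_b}`, `i_b = ⌊t_b i/t⌋`, built from invertible
elements `Q^{(a)}_j` of a commutative `ℚ`-algebra. -/
noncomputable def zQ {R : Type*} [CommRing R] (D : CartanDatum n)
    (Q : Fin n → ℕ → Rˣ) (i : ℕ) (a : Fin n) (j : ℕ) : R :=
  (((∏ b, Q b ((D.t b * i) / D.tmax)
        ^ ((D.C b a) * (j : ℤ) - (D.C a b) * ((((D.t b * i) / D.tmax : ℕ) : ℤ) + 1))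
      * Q b ((D.t b * i) / D.tmax + 1)
        ^ (-((D.C b a) * (j : ℤ)) + (D.C a b) * (((D.t b * i) / D.tmax : ℕ) : ℤ))) : Rˣ) : R)

/-- The symmetrized form is symmetric. -/
lemma form_symm (D : CartanDatum n) (a b : Fin n) : D.form a b = D.form b a := by
  unfold CartanDatum.form
  have ha : (D.t a : ℚ) ≠ 0 := by exact_mod_cast (D.t_pos a).ne'
  have hb : (D.t b : ℚ) ≠ 0 := by exact_mod_cast (D.t_pos b).ne'
  have h : (D.t b : ℚ) * D.C a b = (D.t a : ℚ) * D.C b a := by exact_mod_cast D.symm a b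
  rw [div_eq_div_iff ha hb]
  linarith

lemma form_nonpos (D : CartanDatum n) (a b : Fin n) (h : a ≠ b) : D.form a b ≤ 0 := by
  unfold CartanDatum.form
  have : (D.C a b : ℚ) ≤ 0 := by exact_mod_cast D.offdiag_nonpos a b h
  exact div_nonpos_of_nonpos_of_nonneg this (by positivity)

lemma C_zero_symm (D : CartanDatum n) (a b : Fin n) (h : D.C a b = 0) : D.C b a = 0 := by
  have h1 := D.symm a b
  rw [h, mul_zero] at h1
  have ha : (D.t a : ℤ) ≠ 0 := by exact_mod_cast (D.t_pos a).ne'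
  rcases mul_eq_zero.1 h1.symm with h | h
  · exact absurd h ha
  · exact h

/-- The bilinear form on root space. -/
noncomputable def bil (D : CartanDatum n) : LinearMap.BilinForm ℚ (Fin n → ℚ) :=
  Matrix.toBilin' (Matrix.of fun a b => D.form a b)

lemma bil_single (D : CartanDatum n) (a b : Fin n) :
    bil D (Pi.single a 1) (Pi.single b 1) = D.form a b := by
  simp [bil, Matrix.toBilin'_single]

lemma bil_pos (D : CartanDatum n) (v : Fin n → ℚ) (hv : v ≠ 0) : 0 < bil D v v := by
  have := D.posdef v hv
  simpa [bil, Matrix.toBilin'_apply, CartanDatum.form] using this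

lemma bil_symm (D : CartanDatum n) (v w : Fin n → ℚ) : bil D v w = bil D w v := by
  simp only [bil, Matrix.toBilin'_apply, Matrix.of_apply]
  rw [Finset.sum_comm]
  refine Finset.sum_congr rfl fun a _ => Finset.sum_congr rfl fun b _ => ?_
  rw [form_symm]; ring

/-- Sum of the simple roots over a finite set. -/
noncomputable def ind (T : Finset (Fin n)) : Fin n → ℚ := ∑ q ∈ T, Pi.single q 1

lemma bil_ind_le (D : CartanDatum n) (T : Finset (Fin n)) (q p : Fin n) (hq : q ∈ T)
    (hp : p ∉ T) : bil D (ind T) (Pi.single p 1) ≤ D.form q p := by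
  unfold ind
  rw [map_sum, LinearMap.sum_apply]
  simp only [bil_single]
  rw [← Finset.add_sum_erase T _ hq]
  have : ∑ x ∈ T.erase q, D.form x p ≤ 0 := by
    refine Finset.sum_nonpos fun x hx => form_nonpos D x p ?_
    rintro rfl
    exact hp (Finset.mem_of_mem_erase hx)
  linarith

/-- Simply laced adjacency. -/
def Sadj (D : CartanDatum n) (a b : Fin n) : Prop := D.C a b ≠ 0 ∧ D.t a = D.t b

lemma chain (D : CartanDatum n) (p q : Fin n) (h : Relation.ReflTransGen (Sadj D) p q) :
    ∃ T : Finset (Fin n), p ∈ T ∧ q ∈ T ∧ (∀ x ∈ T, D.t x = D.t p) ∧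
      bil D (ind T) (ind T) ≤ 2 / (D.t p : ℚ) := by
  induction h with
  | refl =>
    refine ⟨{p}, by simp, by simp, by simp, ?_⟩
    simp [ind, bil_single, CartanDatum.form, D.diag]
  | @tail q q' _ hqq ih =>
    obtain ⟨T, hp, hq, hT, hB⟩ := ih
    by_cases hm : q' ∈ T
    · exact ⟨T, hp, hm, hT, hB⟩
    · have htq := hT q hq
      have htq' : D.t q' = D.t p := by rw [← hqq.2, htq]
      refine ⟨insert q' T, by simp [hp], by simp, ?_, ?_⟩
      · intro x hx
        rcases Finset.mem_insert.1 hx with rfl | hx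
        · exact htq'
        · exact hT x hx
      · have e : ind (insert q' T) = Pi.single q' 1 + ind T := by
          unfold ind; rw [Finset.sum_insert hm]
        have h1 := bil_ind_le D T q q' hq hm
        have hne : q ≠ q' := by rintro rfl; exact hm hq
        have hC : (D.C q q' : ℚ) ≤ -1 := by
          have := D.offdiag_nonpos q q' hne
          have := hqq.1
          have : D.C q q' ≤ -1 := by omega
          exact_mod_cast this
        have hf : D.form q q' ≤ -1 / (D.t p : ℚ) := by
          unfold CartanDatum.form
          rw [htq]
          gcongr
        have hd : D.form q' q' = 2 / (D.t p : ℚ) := by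
          unfold CartanDatum.form
          rw [htq', D.diag]; simp
        simp only [e, map_add, LinearMap.add_apply, bil_single, bil_symm D (Pi.single q' 1) (ind T), hd]
        have : -1 / (D.t p : ℚ) = - (1 / 2) * (2 / (D.t p : ℚ)) := by ring
        linarith

/-- A non simply laced edge gives a large projection. -/
lemma multi (D : CartanDatum n) (p q : Fin n) (h : D.C p q ≠ 0) (ht : D.t p ≠ D.t q) :
    (D.C p q : ℚ) ≤ -1 ∧ (D.C p q : ℚ) * D.form p q ≥ 2 / (D.t q : ℚ) := by
  have hne : p ≠ q := by rintro rfl; exact ht rfl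
  have h1 := D.offdiag_nonpos p q hne
  have h2 := D.offdiag_nonpos q p hne.symm
  have h' : D.C q p ≠ 0 := fun h0 => h (C_zero_symm D q p h0)
  have h3 : D.C p q ≤ -1 := by omega
  have h4 : D.C q p ≤ -1 := by omega
  refine ⟨by exact_mod_cast h3, ?_⟩
  have hprod : 2 ≤ D.C p q * D.C q p := by
    by_cases e1 : D.C p q = -1
    · by_cases e2 : D.C q p = -1
      · exfalso
        have := D.symm p q
        rw [e1, e2] at this
        omega
      · have : D.C q p ≤ -2 := by omega
        nlinarith
    · have : D.C p q ≤ -2 := by omega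
      nlinarith
  rw [form_symm]
  unfold CartanDatum.form
  have : (2 : ℚ) ≤ D.C p q * D.C q p := by exact_mod_cast hprod
  rw [← mul_div_assoc]
  gcongr

lemma no_two (D : CartanDatum n) (p q x y : Fin n)
    (h : Relation.ReflTransGen (Sadj D) p q)
    (hx : D.C x p ≠ 0) (htx : D.t x ≠ D.t p) (hy : D.C y q ≠ 0) (hty : D.t y ≠ D.t q) :
    x = y := by
  by_contra hxy
  obtain ⟨T, hp, hq, hT, hB⟩ := chain D p q h
  have hxT : x ∉ T := fun hm => htx (hT x hm)
  have hyT : y ∉ T := fun hm => hty ((hT y hm).trans (hT q hq).symm)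
  obtain ⟨cx, mx⟩ := multi D x p hx htx
  obtain ⟨cy, my⟩ := multi D y q hy hty
  rw [hT q hq] at my
  have bx := bil_ind_le D T p x hp hxT
  have bY := bil_ind_le D T q y hq hyT
  rw [form_symm] at bx bY
  have dx : D.form x x * (D.C x p) = 2 * D.form x p := by
    unfold CartanDatum.form; rw [D.diag]; push_cast; ring
  have dy : D.form y y * (D.C y q) = 2 * D.form y q := by
    unfold CartanDatum.form; rw [D.diag]; push_cast; ring
  have fxy := form_nonpos D x y hxy
  have fyx := form_nonpos D y x (Ne.symm hxy)
  generalize hX : (D.C x p : ℚ) = X at *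
  generalize hY : (D.C y q : ℚ) = Y at *
  set v : Fin n → ℚ := ind T + (-X / 2) • Pi.single x 1 + (-Y / 2) • Pi.single y 1 with hv
  have hv0 : v ≠ 0 := by
    intro h0
    have := congrFun h0 p
    have hpx : p ≠ x := by rintro rfl; exact hxT hp
    have hpy : p ≠ y := by rintro rfl; exact hyT hp
    simp [hv, ind, hpx, hpy, Finset.sum_apply, Pi.single_apply, hp] at this
  have hpos := bil_pos D v hv0
  rw [hv] at hpos
  simp only [map_add, LinearMap.add_apply, map_smul, LinearMap.smul_apply, smul_eq_mul,
    bil_single, bil_symm D (Pi.single _ 1) (ind T)] at hpos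
  have e1 : X * bil D (ind T) (Pi.single x 1) ≥ X * D.form x p := by nlinarith
  have e2 : Y * bil D (ind T) (Pi.single y 1) ≥ Y * D.form y q := by nlinarith
  have e3 : X * (D.form x x * X) = 2 * (X * D.form x p) := by rw [dx]; ring
  have e4 : Y * (D.form y y * Y) = 2 * (Y * D.form y q) := by rw [dy]; ring
  have hXY : 0 ≤ X * Y := by nlinarith
  have e5 : X * Y * D.form x y ≤ 0 := mul_nonpos_of_nonneg_of_nonpos hXY fxy
  have e6 : X * Y * D.form y x ≤ 0 := mul_nonpos_of_nonneg_of_nonpos hXY fyx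
  nlinarith

lemma le_tmax (D : CartanDatum n) (b : Fin n) : D.t b ≤ D.tmax :=
  Finset.le_sup (f := D.t) (Finset.mem_univ b)

/-- In finite type every `t_b` divides `t`. -/
lemma dvd_tmax (D : CartanDatum n) (b : Fin n) : D.t b ∣ D.tmax := by
  obtain ⟨u, hu⟩ := D.normalized
  obtain ⟨m, -, hm⟩ := Finset.exists_mem_eq_sup (Finset.univ : Finset (Fin n)) ⟨b, by simp⟩ D.t
  change D.tmax = D.t m at hm
  have reach : ∀ p q, Relation.ReflTransGen (Sadj D) p q → D.t q = D.t p := by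
    intro p q h
    induction h with
    | refl => rfl
    | tail _ h ih => rw [← h.2, ih]
  have sy : ∀ p q, Relation.ReflTransGen (Sadj D) p q → Relation.ReflTransGen (Sadj D) q p := by
    intro p q h
    induction h with
    | refl => exact .refl
    | tail _ hxy ih =>
      exact Relation.ReflTransGen.head
        ⟨fun h0 => hxy.1 (C_zero_symm D _ _ h0), hxy.2.symm⟩ ih
  let R := Relation.ReflTransGen (Sadj D)
  have fin : ∀ s', (∀ a, D.t a = D.t b ∨ D.t a = s') → D.t b ∣ D.tmax := by
    intro s' h
    have hb1 := le_tmax D b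
    have hb0 := D.t_pos b
    by_cases h1 : D.t b = 1
    · rw [h1]; exact one_dvd _
    · have hs : s' = 1 := by
        rcases h u with h | h <;> omega
      have : D.t b = D.tmax := by
        rcases h m with h | h <;> omega
      rw [this]
  by_cases hout : ∃ p x, R b p ∧ ¬ R b x ∧ D.C p x ≠ 0
  · obtain ⟨p, x, hp, hx, hpx⟩ := hout
    have hxp : D.C x p ≠ 0 := fun h0 => hpx (C_zero_symm D x p h0)
    have htx : D.t x ≠ D.t p := fun h => hx (hp.tail ⟨hpx, h.symm⟩)
    apply fin (D.t x)
    have key := D.connected {a | R b a ∨ R x a} ⟨b, Or.inl .refl⟩ ?_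
    · intro a
      rcases key a with h | h
      · exact Or.inl (reach _ _ h)
      · exact Or.inr (reach _ _ h)
    · rintro a ha y hy
      by_contra hay
      have hya : D.C y a ≠ 0 := fun h0 => hay (C_zero_symm D y a h0)
      simp only [Set.mem_ofPred_eq, not_or] at hy
      rcases ha with ha | ha
      · have hty : D.t y ≠ D.t a := fun h => hy.1 (ha.tail ⟨hay, h.symm⟩)
        have := no_two D p a x y ((sy _ _ hp).trans ha) hxp htx hya hty
        subst this
        exact hy.2 .refl
      · have hty : D.t y ≠ D.t a := fun h => hy.2 (ha.tail ⟨hay, h.symm⟩)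
        have := no_two D x a p y ha hpx (Ne.symm htx) hya hty
        subst this
        exact hy.1 hp
  · push Not at hout
    apply fin (D.t b)
    intro a
    have key := D.connected {a | R b a} ⟨b, .refl⟩ (fun a ha y hy => hout a y ha hy) a
    exact Or.inl (reach _ _ key)

lemma div_of_dvd (s T i : ℕ) (hs : 0 < s) (hT : s ≤ T) (hi : 1 ≤ i) (h : T ∣ s * i) :
    s * (i - 1) / T + 1 = s * i / T := by
  obtain ⟨m, hm⟩ := h
  obtain ⟨i, rfl⟩ : ∃ k, i = k + 1 := ⟨i - 1, by omega⟩
  have hT0 : 0 < T := by omega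
  rw [hm, Nat.mul_div_cancel_left _ hT0, Nat.add_sub_cancel]
  obtain ⟨m, rfl⟩ : ∃ k, m = k + 1 := by
    refine ⟨m - 1, ?_⟩
    rcases Nat.eq_zero_or_pos m with rfl | h
    · simp at hm; omega
    · omega
  congr 1
  rw [Nat.div_eq_iff hT0]
  have e1 : s * i + s = m * T + T := by linarith
  omega

lemma div_of_not_dvd (s T i : ℕ) (hs : 0 < s) (hT : s ∣ T) (hT0 : 0 < T) (hi : 1 ≤ i)
    (h : ¬ T ∣ s * i) : s * (i - 1) / T = s * i / T := by
  obtain ⟨r, rfl⟩ := hT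
  rw [Nat.mul_dvd_mul_iff_left hs] at h
  rw [Nat.mul_div_mul_left _ _ hs, Nat.mul_div_mul_left _ _ hs]
  obtain ⟨i, rfl⟩ : ∃ k, i = k + 1 := ⟨i - 1, by omega⟩
  rw [Nat.add_sub_cancel, Nat.succ_div, if_neg h, add_zero]

lemma prod_floor {G : Type*} [CommGroup G] (f : ℕ → G) (N c : ℕ) (hc : 0 < c) :
    ∏ k ∈ Finset.range c, f ((N + k) / c)
      = f (N / c) ^ ((c : ℤ) * ((N / c : ℕ) + 1) - N) * f (N / c + 1) ^ ((N : ℤ) - c * (N / c : ℕ)) := by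
  have hdm := Nat.div_add_mod N c
  have hlt := Nat.mod_lt N hc
  generalize N / c = m at *
  generalize N % c = r at *
  subst hdm
  have e : c = (c - r) + r := by omega
  have e1 : ((c : ℤ) * ((m : ℕ) + 1) - ((c * m + r : ℕ) : ℤ)) = ((c - r : ℕ) : ℤ) := by
    rw [Nat.cast_sub hlt.le]; push_cast; ring
  have e2 : (((c * m + r : ℕ) : ℤ) - c * (m : ℕ)) = (r : ℤ) := by push_cast; ring
  rw [e1, e2, zpow_natCast, zpow_natCast]
  have : ∀ g : ℕ → G, ∏ k ∈ Finset.range c, g k =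
      (∏ k ∈ Finset.range (c - r), g k) * ∏ k ∈ Finset.range r, g (c - r + k) := by
    intro g
    conv_lhs => rw [e]
    rw [Finset.prod_range_add]
  rw [this]
  congr 1
  · rw [Finset.prod_congr rfl (g := fun _ => f m), Finset.prod_const, Finset.card_range]
    intro k hk
    rw [Finset.mem_range] at hk
    congr 1
    rw [Nat.div_eq_iff hc]
    rw [mul_comm m c]
    omega
  · rw [Finset.prod_congr rfl (g := fun _ => f (m + 1)), Finset.prod_const, Finset.card_range]
    intro k hk
    rw [Finset.mem_range] at hk
    congr 1
    rw [Nat.div_eq_iff hc, add_mul, mul_comm m c]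
    omega

lemma fdiv_conv (C C' : ℤ) (c d j k : ℕ) (hc : C = -(c : ℤ)) (hd : C' = -(d : ℤ)) :
    ((C' * (j : ℤ) - (k : ℤ)).fdiv C).toNat = (d * j + k) / c := by
  subst hc hd
  have : -(d : ℤ) * (j : ℤ) - (k : ℤ) = -((d * j + k : ℕ) : ℤ) := by push_cast; ring
  rw [this, Int.neg_fdiv_neg, Int.fdiv_eq_ediv_of_nonneg _ (by positivity)]
  norm_cast

/-- The factor of `z` at the node `b`, as a unit. -/
def zfac {G : Type*} [CommGroup G] (D : CartanDatum n) (Q : Fin n → ℕ → G) (i : ℕ) (a : Fin n)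
    (j : ℕ) (b : Fin n) : G :=
  Q b ((D.t b * i) / D.tmax)
        ^ ((D.C b a) * (j : ℤ) - (D.C a b) * ((((D.t b * i) / D.tmax : ℕ) : ℤ) + 1))
      * Q b ((D.t b * i) / D.tmax + 1)
        ^ (-((D.C b a) * (j : ℤ)) + (D.C a b) * (((D.t b * i) / D.tmax : ℕ) : ℤ))

lemma zfac_eq {G : Type*} [CommGroup G] (D : CartanDatum n) (Q : Fin n → ℕ → G) (i : ℕ)
    (hi : 1 ≤ i) (a : Fin n) (ha : D.tmax ∣ D.t a * i) (b : Fin n) :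
    zfac D Q (i - 1) a (D.t a * i / D.tmax) b =
      (if a = b then Q a (D.t a * i / D.tmax) ^ (-2 : ℤ) else 1) *
      (if D.C a b < 0 then ∏ k ∈ Finset.range (-(D.C a b)).toNat,
        Q b ((((D.C b a) * ((D.t a * i / D.tmax : ℕ) : ℤ) - (k : ℤ)).fdiv (D.C a b)).toNat) else 1) := by
  have hT0 : 0 < D.tmax := (D.t_pos a).trans_le (le_tmax D a)
  by_cases hab : a = b
  · subst hab
    have h := div_of_dvd _ _ i (D.t_pos a) (le_tmax D a) hi ha
    have hd := D.diag a
    simp only [zfac, hd, if_true]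
    rw [← h, if_neg (by norm_num), mul_one]
    generalize D.t a * (i - 1) / D.tmax = m
    have e1 : (2 : ℤ) * ((m + 1 : ℕ) : ℤ) - 2 * ((m : ℤ) + 1) = 0 := by push_cast; ring
    have e2 : -((2 : ℤ) * ((m + 1 : ℕ) : ℤ)) + 2 * (m : ℤ) = -2 := by push_cast; ring
    rw [e1, e2, zpow_zero, one_mul]
  · rw [if_neg hab, one_mul]
    by_cases hC : D.C a b < 0
    · rw [if_pos hC]
      have hC' : D.C b a < 0 := by
        have h1 := D.offdiag_nonpos b a (Ne.symm hab)
        have : D.C b a ≠ 0 := fun h0 => hC.ne (C_zero_symm D b a h0)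
        omega
      obtain ⟨c, hc⟩ : ∃ c : ℕ, D.C a b = -(c : ℤ) := ⟨(-(D.C a b)).toNat, by omega⟩
      obtain ⟨d, hd⟩ : ∃ d : ℕ, D.C b a = -(d : ℤ) := ⟨(-(D.C b a)).toNat, by omega⟩
      have hc0 : 0 < c := by omega
      have hsym : D.t b * c = D.t a * d := by
        have := D.symm a b
        rw [hc, hd] at this
        have h2 : (D.t b : ℤ) * c = D.t a * d := by linarith
        exact_mod_cast h2
      simp only [fdiv_conv _ _ c d _ _ hc hd]
      have : (-(D.C a b)).toNat = c := by omega
      rw [this, prod_floor (Q b) _ c hc0]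
      obtain ⟨j, hj⟩ := ha
      have hja : D.t a * i / D.tmax = j := by rw [hj, Nat.mul_div_cancel_left _ hT0]
      rw [hja]
      have hNT : (d * j) * D.tmax = c * (D.t b * i) := by
        calc (d * j) * D.tmax = d * (D.tmax * j) := by ring
          _ = (D.t a * d) * i := by rw [← hj]; ring
          _ = _ := by rw [← hsym]; ring
      have hq : d * j / c = D.t b * i / D.tmax := by
        rw [← Nat.mul_div_mul_right (d * j) c hT0, hNT, Nat.mul_div_mul_left _ _ hc0]
      rw [hq]
      unfold zfac
      rw [hc, hd]
      by_cases hb : D.tmax ∣ D.t b * i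
      · have h := div_of_dvd _ _ i (D.t_pos b) (le_tmax D b) hi hb
        have hN : d * j = c * (D.t b * i / D.tmax) := by
          obtain ⟨m, hm⟩ := hb
          rw [hm, Nat.mul_div_cancel_left _ hT0]
          rw [hm] at hNT
          apply Nat.eq_of_mul_eq_mul_right hT0
          rw [hNT]; ring
        have hNz : (d : ℤ) * j = c * ((D.t b * i / D.tmax : ℕ) : ℤ) := by exact_mod_cast hN
        rw [← h] at hNz ⊢
        generalize D.t b * (i - 1) / D.tmax = m at *
        push_cast at hNz ⊢
        have e1 : -(d : ℤ) * j - -(c : ℤ) * (m + 1) = 0 := by linarith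
        have e2 : -(-(d : ℤ) * j) + -(c : ℤ) * m = c := by linarith
        have e3 : (c : ℤ) * ((m : ℤ) + 1 + 1) - d * j = c := by linarith
        have e4 : (d : ℤ) * j - c * ((m : ℤ) + 1) = 0 := by linarith
        rw [e1, e2, e3, e4, zpow_zero, zpow_zero, one_mul, mul_one]
      · rw [div_of_not_dvd _ _ i (D.t_pos b) (dvd_tmax D b) hT0 hi hb]
        push_cast
        congr 2 <;> ring
    · rw [if_neg hC]
      have h0 : D.C a b = 0 := by
        have := D.offdiag_nonpos a b hab
        omega
      simp [zfac, h0, C_zero_symm D a b h0]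

lemma zQ_eq {R : Type*} [CommRing R] (D : CartanDatum n) (Q : Fin n → ℕ → Rˣ) (i : ℕ)
    (a : Fin n) (j : ℕ) : zQ D Q i a j = ((∏ b, zfac D Q i a j b : Rˣ) : R) := rfl

lemma group_id {G : Type*} [CommGroup G] (x y w : G) (E c m : ℤ) :
    y ^ (E - c * (m + 1 + 1)) * w ^ (-E + c * (m + 1)) * (x * w * y ^ (-2 : ℤ)) ^ (E - c * (m + 1))
      = x ^ (E - c * (m + 1)) * y ^ (-E + c * m) := by
  apply Additive.ofMul.injective
  simp only [ofMul_mul, ofMul_zpow]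
  module

lemma clear_denoms {G : Type*} [CommGroup G] (X Y u : G) (e : ℤ) (h : X * u ^ e = Y) :
    X * u ^ e.toNat = Y * u ^ (-e).toNat := by
  rw [← h, mul_assoc, ← zpow_natCast, ← zpow_natCast, ← zpow_add]
  congr 2
  omega

lemma partII (D : CartanDatum n) {R : Type*} [CommRing R] (Q : Fin n → ℕ → Rˣ)
    (hQsys : ∀ a, ∀ j : ℕ, 1 ≤ j →
      ((Q a j : R))^2 = (Q a (j+1) : R) * (Q a (j-1) : R) +
        ∏ b ∈ Finset.univ.filter (fun b => D.C a b < 0),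
          ∏ k ∈ Finset.range (-(D.C a b)).toNat,
            ((Q b ((((D.C b a) * (j : ℤ) - (k : ℤ)).fdiv (D.C a b)).toNat)) : R))
    (i : ℕ) (hi : 1 ≤ i) (a : Fin n) (ha : D.tmax ∣ D.t a * i) :
    (1 - zQ D Q (i-1) a ((D.t a * i) / D.tmax)) * ((Q a ((D.t a * i) / D.tmax) : R))^2
        = (Q a ((D.t a * i) / D.tmax - 1) : R) * (Q a ((D.t a * i) / D.tmax + 1) : R) := by
  have h := div_of_dvd _ _ i (D.t_pos a) (le_tmax D a) hi ha
  have hs := hQsys a (D.t a * i / D.tmax) (h ▸ Nat.le_add_left 1 _)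
  have hz : zQ D Q (i-1) a ((D.t a * i) / D.tmax) * ((Q a ((D.t a * i) / D.tmax) : R))^2
      = ∏ b ∈ Finset.univ.filter (fun b => D.C a b < 0),
          ∏ k ∈ Finset.range (-(D.C a b)).toNat,
            ((Q b ((((D.C b a) * ((D.t a * i / D.tmax : ℕ) : ℤ) - (k : ℤ)).fdiv (D.C a b)).toNat)) : R) := by
    rw [zQ_eq, Finset.prod_congr rfl (fun b _ => zfac_eq D Q i hi a ha b), Finset.prod_mul_distrib,
      Finset.prod_ite_eq, if_pos (Finset.mem_univ a), ← Finset.prod_filter]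
    simp only [← Units.coe_prod, ← Units.val_pow_eq_pow_val, ← Units.val_mul]
    congr 1
    rw [mul_right_comm, ← zpow_natCast, ← zpow_add]
    simp
  rw [sub_mul, hz, hs]
  ring

/-- Lemma: solution of the `z`-recursion by the `Q`-system.
If invertible elements `Q^{(a)}_j` of a commutative `ℚ`-algebra satisfy the
`Q`-system of type `X_n` with `Q^{(a)}_0 = 1`, then the elements `z^{(a)}_{j,i}`
defined above satisfy
(i) the recursion
`z^{(a)}_{j,i} = z^{(a)}_{j,i−1} ∏_b (1 − z^{(b)}_{(t_b/t)i,i−1})^{−C_{ba}(j−(t_a/t)i)}`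
for `(a,j) ∈ H_l[i+1]`, `1 ≤ i ≤ tl−1` (factors with `(t_b/t)i ∉ ℤ` equal to `1`;
stated with denominators cleared), and
(ii) `1 − z^{(a)}_{(t_a/t)i,i−1} = Q^{(a)}_{(t_a/t)i−1} Q^{(a)}_{(t_a/t)i+1} / (Q^{(a)}_{(t_a/t)i})²`
whenever `(t_a/t)i ∈ ℤ` (stated with denominators cleared). -/
theorem statement15 (n : ℕ) (D : CartanDatum n) (l : ℕ) (hl : 1 ≤ l)
    {R : Type*} [CommRing R] [Algebra ℚ R]
    (Q : Fin n → ℕ → Rˣ)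
    (hQ0 : ∀ a, (Q a 0 : R) = 1)
    (hQsys : ∀ a, ∀ j : ℕ, 1 ≤ j →
      ((Q a j : R))^2 = (Q a (j+1) : R) * (Q a (j-1) : R) +
        ∏ b ∈ Finset.univ.filter (fun b => D.C a b < 0),
          ∏ k ∈ Finset.range (-(D.C a b)).toNat,
            ((Q b ((((D.C b a) * (j : ℤ) - (k : ℤ)).fdiv (D.C a b)).toNat)) : R)) :
    (∀ i : ℕ, 1 ≤ i → i + 1 ≤ D.tmax * l → ∀ (a : Fin n) (j : ℕ),
      D.t a * i < D.tmax * j → j ≤ D.t a * l →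
      zQ D Q i a j * (∏ b,
          (if D.tmax ∣ D.t b * i then
            (1 - zQ D Q (i-1) b ((D.t b * i) / D.tmax))
              ^ (((D.C b a) * (j : ℤ)
                  - (D.C a b) * (((D.t b * i) / D.tmax : ℕ) : ℤ)).toNat)
          else 1))
        = zQ D Q (i-1) a j * (∏ b,
            (if D.tmax ∣ D.t b * i then
              (1 - zQ D Q (i-1) b ((D.t b * i) / D.tmax))
                ^ ((-((D.C b a) * (j : ℤ)
                    - (D.C a b) * (((D.t b * i) / D.tmax : ℕ) : ℤ))).toNat)
            else 1)))
    ∧ (∀ i : ℕ, 1 ≤ i → i ≤ D.tmax * l → ∀ a : Fin n, D.tmax ∣ D.t a * i →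
      (1 - zQ D Q (i-1) a ((D.t a * i) / D.tmax)) * ((Q a ((D.t a * i) / D.tmax) : R))^2
        = (Q a ((D.t a * i) / D.tmax - 1) : R) * (Q a ((D.t a * i) / D.tmax + 1) : R)) := by
  refine ⟨?_, fun i hi _ a ha => partII D Q hQsys i hi a ha⟩
  intro i hi _ a j _ _
  have hT0 : 0 < D.tmax := (D.t_pos a).trans_le (le_tmax D a)
  let u : Fin n → Rˣ := fun b => Q b ((D.t b * i) / D.tmax - 1) * Q b ((D.t b * i) / D.tmax + 1)
    * Q b ((D.t b * i) / D.tmax) ^ (-2 : ℤ)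
  have hu : ∀ b, D.tmax ∣ D.t b * i →
      1 - zQ D Q (i-1) b ((D.t b * i) / D.tmax) = (u b : R) := by
    intro b hb
    have h := partII D Q hQsys i hi b hb
    rw [← Units.val_pow_eq_pow_val, ← Units.val_mul, ← Units.eq_mul_inv_iff_mul_eq,
      ← Units.val_mul] at h
    rw [h]
    simp only [u]
    rw [zpow_neg]
    rfl
  have hcoe : ∀ e : Fin n → ℕ, (∏ b, (if D.tmax ∣ D.t b * i then
      (1 - zQ D Q (i-1) b ((D.t b * i) / D.tmax)) ^ e b else 1))
      = ((∏ b, (if D.tmax ∣ D.t b * i then u b ^ e b else 1) : Rˣ) : R) := by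
    intro e
    rw [Units.coe_prod]
    refine Finset.prod_congr rfl fun b _ => ?_
    by_cases hb : D.tmax ∣ D.t b * i
    · rw [if_pos hb, if_pos hb, hu b hb, Units.val_pow_eq_pow_val]
    · rw [if_neg hb, if_neg hb, Units.val_one]
  rw [hcoe, hcoe, zQ_eq, zQ_eq, ← Units.val_mul, ← Units.val_mul, ← Finset.prod_mul_distrib,
    ← Finset.prod_mul_distrib]
  congr 1
  refine Finset.prod_congr rfl fun b _ => ?_
  by_cases hb : D.tmax ∣ D.t b * i
  · rw [if_pos hb, if_pos hb]
    apply clear_denoms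
    have h := div_of_dvd _ _ i (D.t_pos b) (le_tmax D b) hi hb
    simp only [zfac, u]
    rw [← h, Nat.add_sub_cancel]
    push_cast
    exact group_id _ _ _ _ _ _
  · rw [if_neg hb, if_neg hb, mul_one, mul_one]
    unfold zfac
    rw [div_of_not_dvd _ _ i (D.t_pos b) (dvd_tmax D b) hT0 hi hb]

end FermionicPaper
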